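/- In the coordinate hypersurface-variation setup, the first variation of the induced metric is ∂_t (h_t)_{ab} |_{t=0} = 2 f K_{ab} + (£_X h)_{ab} at every point of U, where (£_X h)_{ab} := Σ_c ( X^c ∂_c h_{ab} + h_{cb} ∂_a X^c + h_{ac} ∂_b X^c ) and h := h₀. -/

import Mathlib

noncomputable section

/-- The partial derivative `∂_a f` of a function on `ℝ^N` in the `a`-th coordinate
direction. -/
def pder {N : ℕ} (f : (Fin N → ℝ) → ℝ) (a : Fin N) (x : Fin N → ℝ) : ℝ :=
  fderiv ℝ f x (Pi.single a 1)

/-- The pointwise inverse components `g^{μν}` of a metric given in components. -/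
def ginv {N : ℕ} (g : (Fin N → ℝ) → Fin N → Fin N → ℝ) (x : Fin N → ℝ)
    (μ ν : Fin N) : ℝ :=
  (Matrix.of (g x))⁻¹ μ ν

/-- The Christoffel symbols
`Γ^l_{μν} = (1/2) Σ_σ g^{lσ} (∂_μ g_{σν} + ∂_ν g_{σμ} − ∂_σ g_{μν})` of the metric `g`. -/
def christoffel {N : ℕ} (g : (Fin N → ℝ) → Fin N → Fin N → ℝ) (x : Fin N → ℝ)
    (l μ ν : Fin N) : ℝ :=
  (1 / 2) * ∑ σ, ginv g x l σ *
    (pder (fun z => g z σ ν) μ x + pder (fun z => g z σ μ) ν x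
      - pder (fun z => g z μ ν) σ x)

/-- The spatial derivative `∂_a φ_t^μ` of the hypersurface family. -/
def Dphi {n : ℕ} (φ : ℝ → (Fin n → ℝ) → Fin (n + 1) → ℝ) (t : ℝ) (y : Fin n → ℝ)
    (a : Fin n) (μ : Fin (n + 1)) : ℝ :=
  pder (fun z => φ t z μ) a y

/-- The induced metric `(h_t)_{ab} = Σ_{μν} g_{μν}(φ_t) ∂_aφ_t^μ ∂_bφ_t^ν`. -/
def indMet {n : ℕ} (g : (Fin (n + 1) → ℝ) → Fin (n + 1) → Fin (n + 1) → ℝ)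
    (φ : ℝ → (Fin n → ℝ) → Fin (n + 1) → ℝ) (t : ℝ) (y : Fin n → ℝ)
    (a b : Fin n) : ℝ :=
  ∑ μ, ∑ ν, g (φ t y) μ ν * Dphi φ t y a μ * Dphi φ t y b ν

/-- The inverse `(h_t)^{ab}` of the induced metric. -/
def indMetInv {n : ℕ} (g : (Fin (n + 1) → ℝ) → Fin (n + 1) → Fin (n + 1) → ℝ)
    (φ : ℝ → (Fin n → ℝ) → Fin (n + 1) → ℝ) (t : ℝ) (y : Fin n → ℝ)
    (a b : Fin n) : ℝ :=
  (Matrix.of (fun a b => indMet g φ t y a b))⁻¹ a b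

/-- The extrinsic curvature
`(K_t)_{ab} = Σ_{μν} g_{μν}(φ_t) ∂_aφ_t^μ (∂_b n_t^ν + Σ_{lσ} Γ^ν_{lσ}(φ_t) ∂_bφ_t^l n_t^σ)`. -/
def extK {n : ℕ} (g : (Fin (n + 1) → ℝ) → Fin (n + 1) → Fin (n + 1) → ℝ)
    (φ nrm : ℝ → (Fin n → ℝ) → Fin (n + 1) → ℝ) (t : ℝ) (y : Fin n → ℝ)
    (a b : Fin n) : ℝ :=
  ∑ μ, ∑ ν, g (φ t y) μ ν * Dphi φ t y a μ *
    (pder (fun z => nrm t z ν) b y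
      + ∑ l, ∑ σ, christoffel g (φ t y) ν l σ * Dphi φ t y b l * nrm t y σ)

/-- The trace `k_t = (h_t)^{ab} (K_t)_{ab}` of the extrinsic curvature. -/
def trExtK {n : ℕ} (g : (Fin (n + 1) → ℝ) → Fin (n + 1) → Fin (n + 1) → ℝ)
    (φ nrm : ℝ → (Fin n → ℝ) → Fin (n + 1) → ℝ) (t : ℝ) (y : Fin n → ℝ) : ℝ :=
  ∑ a, ∑ b, indMetInv g φ t y a b * extK g φ nrm t y a b

/-- The Riemann curvature components
`R^l_{αμβ} = ∂_μ Γ^l_{αβ} − ∂_β Γ^l_{αμ} + Σ_σ (Γ^l_{σμ} Γ^σ_{αβ} − Γ^l_{σβ} Γ^σ_{αμ})`. -/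
def riemann {N : ℕ} (g : (Fin N → ℝ) → Fin N → Fin N → ℝ) (x : Fin N → ℝ)
    (l α μ β : Fin N) : ℝ :=
  pder (fun z => christoffel g z l α β) μ x
    - pder (fun z => christoffel g z l α μ) β x
    + ∑ σ, (christoffel g x l σ μ * christoffel g x σ α β
        - christoffel g x l σ β * christoffel g x σ α μ)

/-- The lowered Riemann tensor `R_{μανβ} = Σ_l g_{μl} R^l_{ανβ}`. -/
def riemannLow {N : ℕ} (g : (Fin N → ℝ) → Fin N → Fin N → ℝ) (x : Fin N → ℝ)
    (μ α ν β : Fin N) : ℝ :=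
  ∑ l, g x μ l * riemann g x l α ν β

/-- The Ricci tensor `Ric_{αβ} = Σ_l R^l_{αlβ}`. -/
def ricci {N : ℕ} (g : (Fin N → ℝ) → Fin N → Fin N → ℝ) (x : Fin N → ℝ)
    (α β : Fin N) : ℝ :=
  ∑ l, riemann g x l α l β

/-- The Christoffel symbols `Γ^{Σ,c}_{ab}` of the induced metric `h₀`. -/
def christoffelInd {n : ℕ} (g : (Fin (n + 1) → ℝ) → Fin (n + 1) → Fin (n + 1) → ℝ)
    (φ : ℝ → (Fin n → ℝ) → Fin (n + 1) → ℝ) (y : Fin n → ℝ) (c a b : Fin n) : ℝ :=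
  (1 / 2) * ∑ d, indMetInv g φ 0 y c d *
    (pder (fun z => indMet g φ 0 z d b) a y + pder (fun z => indMet g φ 0 z d a) b y
      - pder (fun z => indMet g φ 0 z a b) d y)

/-- The bilinear form with components `m`. -/
def bilSum {N : ℕ} (m : Fin N → Fin N → ℝ) (u v : Fin N → ℝ) : ℝ :=
  ∑ μ, ∑ ν, m μ ν * u μ * v ν

/-- The derivative of the components `g` at `x` in the direction `w`. -/
def dirDeriv {N : ℕ} (g : (Fin N → ℝ) → Fin N → Fin N → ℝ) (x w : Fin N → ℝ)
    (μ ν : Fin N) : ℝ :=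
  ∑ l, pder (fun z => g z μ ν) l x * w l

section BilSum

variable {N : ℕ}

lemma bilSum_add_left (m : Fin N → Fin N → ℝ) (u u' v : Fin N → ℝ) :
    bilSum m (u + u') v = bilSum m u v + bilSum m u' v := by
  simp only [bilSum, ← Finset.sum_add_distrib, Pi.add_apply]
  exact Finset.sum_congr rfl fun _ _ => Finset.sum_congr rfl fun _ _ => by ring

lemma bilSum_smul_left (m : Fin N → Fin N → ℝ) (r : ℝ) (u v : Fin N → ℝ) :
    bilSum m (r • u) v = r * bilSum m u v := by
  simp only [bilSum, Finset.mul_sum, Pi.smul_apply, smul_eq_mul]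
  exact Finset.sum_congr rfl fun _ _ => Finset.sum_congr rfl fun _ _ => by ring

lemma bilSum_comm {m : Fin N → Fin N → ℝ} (hm : ∀ μ ν, m μ ν = m ν μ) (u v : Fin N → ℝ) :
    bilSum m u v = bilSum m v u := by
  unfold bilSum
  rw [Finset.sum_comm]
  exact Finset.sum_congr rfl fun ν _ => Finset.sum_congr rfl fun μ _ => by rw [hm μ ν]; ring

lemma bilSum_sum_left {ι : Type*} (s : Finset ι) (m : Fin N → Fin N → ℝ)
    (u : ι → Fin N → ℝ) (v : Fin N → ℝ) :
    bilSum m (∑ i ∈ s, u i) v = ∑ i ∈ s, bilSum m (u i) v := by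
  classical
  induction s using Finset.induction_on with
  | empty => simp [bilSum]
  | insert i s hi ih => rw [Finset.sum_insert hi, Finset.sum_insert hi, bilSum_add_left, ih]

lemma bilSum_dirDeriv_add (g : (Fin N → ℝ) → Fin N → Fin N → ℝ) (x w w' u v : Fin N → ℝ) :
    bilSum (dirDeriv g x (w + w')) u v
      = bilSum (dirDeriv g x w) u v + bilSum (dirDeriv g x w') u v := by
  simp only [bilSum, dirDeriv, Pi.add_apply, mul_add, add_mul, Finset.sum_add_distrib]

lemma bilSum_dirDeriv_smul (g : (Fin N → ℝ) → Fin N → Fin N → ℝ) (r : ℝ)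
    (x w u v : Fin N → ℝ) :
    bilSum (dirDeriv g x (r • w)) u v = r * bilSum (dirDeriv g x w) u v := by
  simp only [bilSum, dirDeriv, Pi.smul_apply, smul_eq_mul, Finset.mul_sum, Finset.sum_mul]
  exact Finset.sum_congr rfl fun _ _ => Finset.sum_congr rfl fun _ _ =>
    Finset.sum_congr rfl fun _ _ => by ring

lemma bilSum_dirDeriv_sum {ι : Type*} (s : Finset ι) (g : (Fin N → ℝ) → Fin N → Fin N → ℝ)
    (x : Fin N → ℝ) (w : ι → Fin N → ℝ) (u v : Fin N → ℝ) :
    bilSum (dirDeriv g x (∑ i ∈ s, w i)) u v = ∑ i ∈ s, bilSum (dirDeriv g x (w i)) u v := by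
  classical
  induction s using Finset.induction_on with
  | empty => simp [bilSum, dirDeriv]
  | insert i s hi ih => rw [Finset.sum_insert hi, Finset.sum_insert hi, bilSum_dirDeriv_add, ih]

end BilSum

/-- The directional derivative as a combination of the partial derivatives. -/
lemma fderiv_apply_eq_sum_pder {N : ℕ} (f : (Fin N → ℝ) → ℝ) (x w : Fin N → ℝ) :
    fderiv ℝ f x w = ∑ l, pder f l x * w l := by
  conv_lhs => rw [pi_eq_sum_univ' w]
  simp only [map_sum, map_smul, smul_eq_mul, pder]
  refine Finset.sum_congr rfl fun l _ => ?_
  rw [mul_comm]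

/-- Product rule for `e ↦ ∑ g_{μν}(p(e)) u^μ(e) v^ν(e)`. -/
lemma fderiv_bilSum_apply {E : Type*} [NormedAddCommGroup E] [NormedSpace ℝ E] {N : ℕ}
    {g : (Fin N → ℝ) → Fin N → Fin N → ℝ} {p u v : E → Fin N → ℝ} {x : E}
    (hg : ∀ μ ν, DifferentiableAt ℝ (fun z => g z μ ν) (p x))
    (hp : ∀ l, DifferentiableAt ℝ (fun e => p e l) x)
    (hu : ∀ μ, DifferentiableAt ℝ (fun e => u e μ) x)
    (hv : ∀ μ, DifferentiableAt ℝ (fun e => v e μ) x) (w : E) :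
    fderiv ℝ (fun e => bilSum (g (p e)) (u e) (v e)) x w
      = bilSum (dirDeriv g (p x) (fun l => fderiv ℝ (fun e => p e l) x w)) (u x) (v x)
        + bilSum (g (p x)) (fun μ => fderiv ℝ (fun e => u e μ) x w) (v x)
        + bilSum (g (p x)) (u x) (fun μ => fderiv ℝ (fun e => v e μ) x w) := by
  have hp' : HasFDerivAt p (ContinuousLinearMap.pi fun l => fderiv ℝ (fun e => p e l) x) x :=
    hasFDerivAt_pi.2 fun l => (hp l).hasFDerivAt
  have hgp : ∀ μ ν, HasFDerivAt (fun e => g (p e) μ ν)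
      ((fderiv ℝ (fun z => g z μ ν) (p x)).comp
        (ContinuousLinearMap.pi fun l => fderiv ℝ (fun e => p e l) x)) x :=
    fun μ ν => (hg μ ν).hasFDerivAt.comp x hp'
  have h := HasFDerivAt.fun_sum (u := Finset.univ) fun μ _ =>
    HasFDerivAt.fun_sum (u := Finset.univ) fun ν _ =>
      ((hgp μ ν).mul (hu μ).hasFDerivAt).mul (hv ν).hasFDerivAt
  have h' := congrArg (fun L => L w) h.fderiv
  refine h'.trans ?_
  simp only [bilSum, ← Finset.sum_add_distrib, sum_apply]
  refine Finset.sum_congr rfl fun μ _ => Finset.sum_congr rfl fun ν _ => ?_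
  simp only [add_apply, smul_apply, smul_eq_mul,
    ContinuousLinearMap.comp_apply, fderiv_apply_eq_sum_pder (fun z => g z μ ν),
    ContinuousLinearMap.pi_apply, dirDeriv, Pi.mul_apply]
  ring

lemma contDiffOn_fderiv_apply {E : Type*} [NormedAddCommGroup E] [NormedSpace ℝ E]
    {F : E → ℝ} {S : Set E} (hS : IsOpen S) (hF : ContDiffOn ℝ (⊤ : ℕ∞) F S) (v : E) :
    ContDiffOn ℝ (⊤ : ℕ∞) (fun q => fderiv ℝ F q v) S :=
  (hF.fderiv_of_isOpen hS (by simp)).clm_apply contDiffOn_const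

lemma fderiv_fderiv_apply_comm {E : Type*} [NormedAddCommGroup E] [NormedSpace ℝ E]
    {F : E → ℝ} {S : Set E} (hS : IsOpen S) (hF : ContDiffOn ℝ (⊤ : ℕ∞) F S) {x : E}
    (hx : x ∈ S) (v w : E) :
    fderiv ℝ (fun q => fderiv ℝ F q v) x w = fderiv ℝ (fun q => fderiv ℝ F q w) x v := by
  have hd : DifferentiableAt ℝ (fderiv ℝ F) x :=
    ((hF.fderiv_of_isOpen (m := (⊤ : ℕ∞)) hS (by simp)).contDiffAt
      (hS.mem_nhds hx)).differentiableAt (by simp)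
  have hs : IsSymmSndFDerivAt ℝ F x :=
    (hF.contDiffAt (hS.mem_nhds hx)).isSymmSndFDerivAt (by simp only [minSmoothness_of_isRCLikeNormedField]; exact WithTop.coe_le_coe.2 le_top)
  have key : ∀ a b : E, fderiv ℝ (fun q => fderiv ℝ F q a) x b = fderiv ℝ (fderiv ℝ F) x b a := by
    intro a b
    rw [fderiv_clm_apply hd (differentiableAt_const a)]
    simp
  rw [key, key]
  exact hs w v

/-- Partial derivatives in the second variable of a product. -/
lemma pder_prodMk {n : ℕ} {F : ℝ × (Fin n → ℝ) → ℝ} {t : ℝ} {y : Fin n → ℝ}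
    (hF : DifferentiableAt ℝ F (t, y)) (a : Fin n) :
    pder (fun z => F (t, z)) a y = fderiv ℝ F (t, y) (0, Pi.single a 1) := by
  have h := hF.hasFDerivAt.comp y (hasFDerivAt_prodMk_right t y)
  have h' := congrArg (fun L => L (Pi.single a (1 : ℝ))) h.fderiv
  exact h'.trans (by simp)

lemma hasDerivAt_prodMk {n : ℕ} {F : ℝ × (Fin n → ℝ) → ℝ} {t : ℝ} {y : Fin n → ℝ}
    (hF : DifferentiableAt ℝ F (t, y)) :
    HasDerivAt (fun s => F (s, y)) (fderiv ℝ F (t, y) (1, 0)) t := by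
  have h := (hF.hasFDerivAt.comp t (hasFDerivAt_prodMk_left t y)).hasDerivAt
  simpa [Function.comp_def] using h

/-- Lowering the upper index of the Christoffel symbols. -/
lemma sum_mul_christoffel {N : ℕ} {g : (Fin N → ℝ) → Fin N → Fin N → ℝ} {x : Fin N → ℝ}
    (hg : IsUnit (Matrix.of (g x)).det) (μ l σ : Fin N) :
    ∑ ν, g x μ ν * christoffel g x ν l σ
      = (1 / 2) * (pder (fun z => g z μ σ) l x + pder (fun z => g z μ l) σ x
        - pder (fun z => g z l σ) μ x) := by
  set c : Fin N → ℝ := fun ρ => pder (fun z => g z ρ σ) l x + pder (fun z => g z ρ l) σ x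
        - pder (fun z => g z l σ) ρ x with hc
  have h : (Matrix.of (g x)).mulVec ((Matrix.of (g x))⁻¹.mulVec c) = c := by
    rw [Matrix.mulVec_mulVec, Matrix.mul_nonsing_inv _ hg, Matrix.one_mulVec]
  have h' := congrFun h μ
  change _ = (1 / 2) * c μ
  rw [← h']
  simp only [Matrix.mulVec, dotProduct, Matrix.of_apply, christoffel, ginv]
  rw [Finset.mul_sum]
  exact Finset.sum_congr rfl fun ν _ => by ring

/-- The Christoffel term of a covariant derivative, paired with a vector. -/
lemma bilSum_christoffel {N : ℕ} {g : (Fin N → ℝ) → Fin N → Fin N → ℝ} {x : Fin N → ℝ}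
    (hg : IsUnit (Matrix.of (g x)).det) (u v w : Fin N → ℝ) :
    bilSum (g x) u (fun ν => ∑ l, ∑ σ, christoffel g x ν l σ * v l * w σ)
      = (1 / 2) * (bilSum (dirDeriv g x v) u w + bilSum (dirDeriv g x w) u v
        - bilSum (dirDeriv g x u) v w) := by
  have hL : bilSum (g x) u (fun ν => ∑ l, ∑ σ, christoffel g x ν l σ * v l * w σ)
      = ∑ μ, ∑ l, ∑ σ, (∑ ν, g x μ ν * christoffel g x ν l σ) * (u μ * v l * w σ) := by
    unfold bilSum
    refine Finset.sum_congr rfl fun μ _ => ?_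
    simp only [Finset.mul_sum, Finset.sum_mul]
    rw [Finset.sum_comm]
    refine Finset.sum_congr rfl fun l _ => ?_
    rw [Finset.sum_comm]
    exact Finset.sum_congr rfl fun σ _ => Finset.sum_congr rfl fun ν _ => by ring
  have h1 : bilSum (dirDeriv g x v) u w
      = ∑ μ, ∑ l, ∑ σ, pder (fun z => g z μ σ) l x * (u μ * v l * w σ) := by
    unfold bilSum dirDeriv
    refine Finset.sum_congr rfl fun μ _ => ?_
    simp only [Finset.sum_mul]
    rw [Finset.sum_comm]
    exact Finset.sum_congr rfl fun l _ => Finset.sum_congr rfl fun σ _ => by ring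
  have h2 : bilSum (dirDeriv g x w) u v
      = ∑ μ, ∑ l, ∑ σ, pder (fun z => g z μ l) σ x * (u μ * v l * w σ) := by
    unfold bilSum dirDeriv
    refine Finset.sum_congr rfl fun μ _ => Finset.sum_congr rfl fun l _ => ?_
    simp only [Finset.sum_mul]
    exact Finset.sum_congr rfl fun σ _ => by ring
  have h3 : bilSum (dirDeriv g x u) v w
      = ∑ μ, ∑ l, ∑ σ, pder (fun z => g z l σ) μ x * (u μ * v l * w σ) := by
    unfold bilSum dirDeriv
    simp only [Finset.sum_mul]
    rw [Finset.sum_comm_cycle]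
    refine Finset.sum_congr rfl fun μ _ => Finset.sum_congr rfl fun l _ =>
      Finset.sum_congr rfl fun σ _ => by ring
  rw [hL, h1, h2, h3]
  simp only [sum_mul_christoffel hg, ← Finset.sum_add_distrib, ← Finset.sum_sub_distrib,
    Finset.mul_sum]
  exact Finset.sum_congr rfl fun _ _ => Finset.sum_congr rfl fun _ _ =>
    Finset.sum_congr rfl fun _ _ => by ring

/-- Lemma 5.5 (1) of the paper, in local coordinates: the first
variation of the induced metric is `∂_t (h_t)_{ab}|_{t=0} = 2 f K_{ab} + (£_X h)_{ab}`. -/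
theorem first_variation_induced_metric
    (n : ℕ) (hn : 1 ≤ n)
    (U : Set (Fin n → ℝ)) (hU : IsOpen U)
    (V : Set (Fin (n + 1) → ℝ)) (hV : IsOpen V)
    (g : (Fin (n + 1) → ℝ) → Fin (n + 1) → Fin (n + 1) → ℝ)
    (hg : ∀ μ ν, ContDiffOn ℝ (⊤ : ℕ∞) (fun x => g x μ ν) V)
    (hgsym : ∀ x ∈ V, ∀ μ ν, g x μ ν = g x ν μ)
    (hgunit : ∀ x ∈ V, IsUnit (Matrix.of (g x)).det)
    (δ : ℝ) (hδ : 0 < δ)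
    (φ : ℝ → (Fin n → ℝ) → Fin (n + 1) → ℝ)
    (hφ : ∀ μ, ContDiffOn ℝ (⊤ : ℕ∞) (fun q : ℝ × (Fin n → ℝ) => φ q.1 q.2 μ)
      (Set.Ioo (-δ) δ ×ˢ U))
    (hφV : ∀ t ∈ Set.Ioo (-δ) δ, ∀ y ∈ U, φ t y ∈ V)
    (himm : ∀ t ∈ Set.Ioo (-δ) δ, ∀ y ∈ U, ∀ v : Fin n → ℝ,
      (∀ μ, (∑ a, v a * Dphi φ t y a μ) = 0) → v = 0)
    (nrm : ℝ → (Fin n → ℝ) → Fin (n + 1) → ℝ)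
    (hnrm : ∀ μ, ContDiffOn ℝ (⊤ : ℕ∞) (fun q : ℝ × (Fin n → ℝ) => nrm q.1 q.2 μ)
      (Set.Ioo (-δ) δ ×ˢ U))
    (ϵ : ℝ) (hϵ : ϵ = 1 ∨ ϵ = -1)
    (horth : ∀ t ∈ Set.Ioo (-δ) δ, ∀ y ∈ U, ∀ a : Fin n,
      (∑ μ, ∑ ν, g (φ t y) μ ν * nrm t y μ * Dphi φ t y a ν) = 0)
    (hunit : ∀ t ∈ Set.Ioo (-δ) δ, ∀ y ∈ U,
      (∑ μ, ∑ ν, g (φ t y) μ ν * nrm t y μ * nrm t y ν) = ϵ)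
    (f : (Fin n → ℝ) → ℝ) (hf : ContDiffOn ℝ (⊤ : ℕ∞) f U)
    (X : (Fin n → ℝ) → Fin n → ℝ) (hX : ∀ a, ContDiffOn ℝ (⊤ : ℕ∞) (fun y => X y a) U)
    (hdec : ∀ y ∈ U, ∀ μ, deriv (fun t => φ t y μ) 0
      = f y * nrm 0 y μ + ∑ a, X y a * Dphi φ 0 y a μ)
    (hh0 : ∀ y ∈ U, IsUnit (Matrix.of (fun a b => indMet g φ 0 y a b)).det) :
    ∀ y ∈ U, ∀ a b : Fin n,
      deriv (fun t => indMet g φ t y a b) 0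
        = 2 * f y * extK g φ nrm 0 y a b
          + ∑ c, (X y c * pder (fun z => indMet g φ 0 z a b) c y
              + indMet g φ 0 y c b * pder (fun z => X z c) a y
              + indMet g φ 0 y a c * pder (fun z => X z c) b y) := by
  intro y hy a b
  set S : Set (ℝ × (Fin n → ℝ)) := Set.Ioo (-δ) δ ×ˢ U with hSdef
  have hS : IsOpen S := isOpen_Ioo.prod hU
  have h0 : (0 : ℝ) ∈ Set.Ioo (-δ) δ := ⟨by linarith, hδ⟩
  have hmem : ∀ z ∈ U, ((0 : ℝ), z) ∈ S := fun z hz => ⟨h0, hz⟩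
  have hdiff : ∀ {F : ℝ × (Fin n → ℝ) → ℝ}, ContDiffOn ℝ (⊤ : ℕ∞) F S → ∀ {q}, q ∈ S →
      DifferentiableAt ℝ F q := fun hF _ hq =>
    (hF.contDiffAt (hS.mem_nhds hq)).differentiableAt (by simp)
  have hUdiff : ∀ {F : (Fin n → ℝ) → ℝ}, ContDiffOn ℝ (⊤ : ℕ∞) F U →
      DifferentiableAt ℝ F y := fun hF =>
    (hF.contDiffAt (hU.mem_nhds hy)).differentiableAt (by simp)
  have hx : φ 0 y ∈ V := hφV 0 h0 y hy
  have hgd : ∀ μ ν, DifferentiableAt ℝ (fun x => g x μ ν) (φ 0 y) := fun μ ν =>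
    ((hg μ ν).contDiffAt (hV.mem_nhds hx)).differentiableAt (by simp)
  have hslice : ∀ {F : ℝ × (Fin n → ℝ) → ℝ}, ContDiffOn ℝ (⊤ : ℕ∞) F S →
      DifferentiableAt ℝ (fun z => F (0, z)) y := fun hF =>
    (hdiff hF (hmem y hy)).comp (f := fun z => ((0 : ℝ), z)) y
      (hasFDerivAt_prodMk_right (𝕜 := ℝ) 0 y).differentiableAt
  -- first derivatives of the embedding as functions on the product
  set D : Fin n → Fin (n + 1) → ℝ × (Fin n → ℝ) → ℝ := fun c μ q =>
    fderiv ℝ (fun q : ℝ × (Fin n → ℝ) => φ q.1 q.2 μ) q (0, Pi.single c 1) with hD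
  set W : Fin (n + 1) → ℝ × (Fin n → ℝ) → ℝ := fun μ q =>
    fderiv ℝ (fun q : ℝ × (Fin n → ℝ) => φ q.1 q.2 μ) q (1, 0) with hW
  have hDs : ∀ c μ, ContDiffOn ℝ (⊤ : ℕ∞) (D c μ) S := fun c μ =>
    contDiffOn_fderiv_apply hS (hφ μ) _
  have hWs : ∀ μ, ContDiffOn ℝ (⊤ : ℕ∞) (W μ) S := fun μ =>
    contDiffOn_fderiv_apply hS (hφ μ) _
  have hDphi : ∀ t ∈ Set.Ioo (-δ) δ, ∀ z ∈ U, ∀ c μ, Dphi φ t z c μ = D c μ (t, z) :=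
    fun t ht z hz c μ => pder_prodMk (F := fun q => φ q.1 q.2 μ)
      (hdiff (hφ μ) (show (t, z) ∈ S from ⟨ht, hz⟩)) c
  have hDphi_U : ∀ c μ, (fun z => Dphi φ 0 z c μ) =ᶠ[nhds y] fun z => D c μ (0, z) := by
    intro c μ
    filter_upwards [hU.mem_nhds hy] with z hz using hDphi 0 h0 z hz c μ
  have hDphi_t : ∀ c μ, (fun t => Dphi φ t y c μ) =ᶠ[nhds 0] fun t => D c μ (t, y) := by
    intro c μ
    filter_upwards [isOpen_Ioo.mem_nhds h0] with t ht using hDphi t ht y hy c μ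
  have hDphi_diff : ∀ c μ, DifferentiableAt ℝ (fun z => Dphi φ 0 z c μ) y := fun c μ =>
    (hDphi_U c μ).differentiableAt_iff.2 (hslice (hDs c μ))
  have hDphi_dt : ∀ c μ, HasDerivAt (fun t => Dphi φ t y c μ)
      (fderiv ℝ (D c μ) (0, y) (1, 0)) 0 := fun c μ =>
    (hasDerivAt_prodMk (hdiff (hDs c μ) (hmem y hy))).congr_of_eventuallyEq (hDphi_t c μ)
  have hHsymm : ∀ c d μ,
      pder (fun z => Dphi φ 0 z c μ) d y = pder (fun z => Dphi φ 0 z d μ) c y := by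
    have key : ∀ c d μ, pder (fun z => Dphi φ 0 z c μ) d y
        = fderiv ℝ (D c μ) (0, y) (0, Pi.single d 1) := by
      intro c d μ
      rw [← pder_prodMk (hdiff (hDs c μ) (hmem y hy)), pder, pder, (hDphi_U c μ).fderiv_eq]
    intro c d μ
    rw [key, key]
    exact fderiv_fderiv_apply_comm hS (hφ μ) (hmem y hy) _ _
  have hφt : ∀ z ∈ U, ∀ μ, HasDerivAt (fun t => φ t z μ) (W μ (0, z)) 0 := fun z hz μ =>
    hasDerivAt_prodMk (F := fun q => φ q.1 q.2 μ) (hdiff (hφ μ) (hmem z hz))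
  have hφd : ∀ μ, DifferentiableAt ℝ (fun z => φ 0 z μ) y := fun μ => hslice (hφ μ)
  have hnd : ∀ μ, DifferentiableAt ℝ (fun z => nrm 0 z μ) y := fun μ => hslice (hnrm μ)
  have hfd : DifferentiableAt ℝ f y := hUdiff hf
  have hXd : ∀ c, DifferentiableAt ℝ (fun z => X z c) y := fun c => hUdiff (hX c)
  -- vectors at the base point
  set A : Fin n → Fin (n + 1) → ℝ := fun c => Dphi φ 0 y c with hA
  set N : Fin (n + 1) → ℝ := nrm 0 y with hN
  set dN : Fin n → Fin (n + 1) → ℝ := fun c μ => pder (fun z => nrm 0 z μ) c y with hdN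
  set H : Fin n → Fin n → Fin (n + 1) → ℝ := fun c d μ =>
    pder (fun z => Dphi φ 0 z c μ) d y with hH
  have hHs : ∀ c d, H c d = H d c := fun c d => funext fun μ => hHsymm c d μ
  set G := g (φ 0 y) with hG
  have hGsym : ∀ μ ν, G μ ν = G ν μ := hgsym _ hx
  have hdGsym : ∀ w μ ν, dirDeriv g (φ 0 y) w μ ν = dirDeriv g (φ 0 y) w ν μ := by
    intro w μ ν
    refine Finset.sum_congr rfl fun l _ => ?_
    have : (fun z => g z μ ν) =ᶠ[nhds (φ 0 y)] fun z => g z ν μ := by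
      filter_upwards [hV.mem_nhds hx] with z hz using hgsym z hz μ ν
    rw [pder, pder, this.fderiv_eq]
  have hWv : (fun μ => W μ (0, y)) = f y • N + ∑ c, X y c • A c := by
    funext μ
    rw [← (hφt y hy μ).deriv, hdec y hy μ]
    simp [hN, hA]
  have hdW : ∀ d, (fun μ => fderiv ℝ (D d μ) (0, y) (1, 0))
      = pder f d y • N + f y • dN d
        + ∑ c, (pder (fun z => X z c) d y • A c + X y c • H c d) := by
    intro d
    funext μ
    have h1 : fderiv ℝ (D d μ) (0, y) (1, 0) = pder (fun z => W μ (0, z)) d y := by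
      rw [pder_prodMk (hdiff (hWs μ) (hmem y hy))]
      exact fderiv_fderiv_apply_comm hS (hφ μ) (hmem y hy) _ _
    have h2 : (fun z => W μ (0, z)) =ᶠ[nhds y]
        fun z => f z * nrm 0 z μ + ∑ c, X z c * Dphi φ 0 z c μ := by
      filter_upwards [hU.mem_nhds hy] with z hz
      rw [← (hφt z hz μ).deriv, hdec z hz μ]
    have h3 := (hfd.hasFDerivAt.mul (hnd μ).hasFDerivAt).add
      (HasFDerivAt.fun_sum (u := Finset.univ) fun c _ =>
        (hXd c).hasFDerivAt.mul (hDphi_diff c μ).hasFDerivAt)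
    have h4 := congrArg (fun L => L (Pi.single d (1 : ℝ))) h3.fderiv
    rw [h1, pder, h2.fderiv_eq]
    refine h4.trans ?_
    simp only [add_apply, sum_apply, smul_apply, smul_eq_mul, Pi.add_apply, Finset.sum_apply,
      Pi.smul_apply, hN, hA, hdN, hH, pder]
    refine congrArg₂ _ (by ring) (Finset.sum_congr rfl fun c _ => by ring)
  -- derivatives of the induced metric
  have ht : deriv (fun t => indMet g φ t y a b) 0
      = bilSum (dirDeriv g (φ 0 y) (fun μ => W μ (0, y))) (A a) (A b)
        + bilSum G (fun μ => fderiv ℝ (D a μ) (0, y) (1, 0)) (A b)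
        + bilSum G (A a) (fun μ => fderiv ℝ (D b μ) (0, y) (1, 0)) := by
    have h := fderiv_bilSum_apply (g := g) (p := fun t => φ t y) (u := fun t => Dphi φ t y a)
      (v := fun t => Dphi φ t y b) (x := (0 : ℝ)) hgd
      (fun l => (hφt y hy l).differentiableAt) (fun μ => (hDphi_dt a μ).differentiableAt)
      (fun μ => (hDphi_dt b μ).differentiableAt) 1
    simp only [fderiv_apply_one_eq_deriv, (hφt y hy _).deriv, (hDphi_dt _ _).deriv] at h
    exact h
  have hs : ∀ c, pder (fun z => indMet g φ 0 z a b) c y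
      = bilSum (dirDeriv g (φ 0 y) (A c)) (A a) (A b) + bilSum G (H a c) (A b)
        + bilSum G (A a) (H b c) := fun c =>
    fderiv_bilSum_apply (g := g) (p := fun z => φ 0 z) (u := fun z => Dphi φ 0 z a)
      (v := fun z => Dphi φ 0 z b) hgd hφd (hDphi_diff a) (hDphi_diff b) (Pi.single c 1)
  have horth0 : ∀ c, bilSum G N (A c) = 0 := fun c => horth 0 h0 y hy c
  have horth1 : ∀ c d, bilSum (dirDeriv g (φ 0 y) (A d)) N (A c) + bilSum G (dN d) (A c)
      + bilSum G N (H c d) = 0 := by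
    intro c d
    have h := fderiv_bilSum_apply (g := g) (p := fun z => φ 0 z) (u := fun z => nrm 0 z)
      (v := fun z => Dphi φ 0 z c) hgd hφd hnd (hDphi_diff c) (Pi.single d 1)
    have hz : (fun z => bilSum (g (φ 0 z)) (nrm 0 z) (Dphi φ 0 z c)) =ᶠ[nhds y]
        fun _ => (0 : ℝ) := by
      filter_upwards [hU.mem_nhds hy] with z hz using horth 0 h0 z hz c
    rw [hz.fderiv_eq, fderiv_const_apply, zero_apply] at h
    exact h.symm
  have hK : extK g φ nrm 0 y a b = bilSum G (dN b) (A a)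
      + (1 / 2) * (bilSum (dirDeriv g (φ 0 y) (A b)) N (A a)
        + bilSum (dirDeriv g (φ 0 y) N) (A a) (A b)
        - bilSum (dirDeriv g (φ 0 y) (A a)) N (A b)) := by
    have h : extK g φ nrm 0 y a b = bilSum G (A a) (dN b + fun ν =>
        ∑ l, ∑ σ, christoffel g (φ 0 y) ν l σ * A b l * N σ) := rfl
    rw [h, bilSum_comm hGsym, bilSum_add_left, bilSum_comm hGsym _ (A a),
      bilSum_comm hGsym _ (A a), bilSum_christoffel (hgunit _ hx),
      bilSum_comm (hdGsym (A b)) (A a) N, bilSum_comm (hdGsym (A a)) (A b) N]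
  have hind : ∀ c d, indMet g φ 0 y c d = bilSum G (A c) (A d) := fun _ _ => rfl
  have e1 := horth1 a b
  have e2 := horth1 b a
  rw [hHs a b] at e1
  rw [ht, hWv, hdW, hdW, hK, bilSum_comm hGsym (A a)]
  simp only [hs, hind, bilSum_add_left, bilSum_smul_left, bilSum_sum_left, bilSum_dirDeriv_add,
    bilSum_dirDeriv_smul, bilSum_dirDeriv_sum, horth0]
  have hsum : ∑ c, X y c * bilSum (dirDeriv g (φ 0 y) (A c)) (A a) (A b)
      + ∑ c, (pder (fun z => X z c) a y * bilSum G (A c) (A b) + X y c * bilSum G (H c a) (A b))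
      + ∑ c, (pder (fun z => X z c) b y * bilSum G (A c) (A a) + X y c * bilSum G (H c b) (A a))
      = ∑ c, (X y c * (bilSum (dirDeriv g (φ 0 y) (A c)) (A a) (A b) + bilSum G (H a c) (A b)
          + bilSum G (A a) (H b c)) + bilSum G (A c) (A b) * pder (fun z => X z c) a y
          + bilSum G (A a) (A c) * pder (fun z => X z c) b y) := by
    simp only [← Finset.sum_add_distrib]
    refine Finset.sum_congr rfl fun c _ => ?_
    rw [hHs a c, hHs b c, bilSum_comm hGsym (A a) (H c b), bilSum_comm hGsym (A a) (A c)]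
    ring
  rw [← hsum]
  linear_combination f y * (e2 - e1)
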